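/- Let 1 ≤ r, s, p ≤ ∞ with r ≠ s and 1/s = 1/p + 1/r (convention 1/∞ = 0), and let q be the conjugate exponent of p. Then for all n×n complex Hermitian matrices A and B, ‖(AB + BA)/2‖_s ≤ 2 C_q · ‖A‖_p · ‖B‖_r (a generalized Hölder type inequality for the Jordan product of Hermitian matrices). -/

import Mathlib

open scoped ENNReal

/-- The spectral `p`-norm of a Hermitian matrix: the `p`-norm of its eigenvalue vector.
(Junk value `0` for non-Hermitian matrices.) -/
noncomputable def specPNorm {n : ℕ} (p : ℝ≥0∞) (A : Matrix (Fin n) (Fin n) ℂ) : ℝ :=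
  if hA : A.IsHermitian then
    (if p = ∞ then ⨆ i, |hA.eigenvalues i|
     else (∑ i, |hA.eigenvalues i| ^ p.toReal) ^ (1 / p.toReal))
  else 0

/-- The operator norm of a real-linear map on Hermitian matrices (represented as a real-linear
map on all matrices), from the spectral `r`-norm to the spectral `s`-norm: the supremum of
`‖T A‖_s / ‖A‖_r` over nonzero Hermitian `A`. -/
noncomputable def hermOpNorm {n : ℕ} (r s : ℝ≥0∞)
    (T : Matrix (Fin n) (Fin n) ℂ →ₗ[ℝ] Matrix (Fin n) (Fin n) ℂ) : ℝ :=
  ⨆ A : {A : Matrix (Fin n) (Fin n) ℂ // A.IsHermitian ∧ A ≠ 0},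
    specPNorm s (T A.1) / specPNorm r A.1


/-- The constant `C_p`: `√2` for `1 ≤ p ≤ 2` and `2^(1/q)` (with `q` the conjugate exponent
of `p`, so `1/q = 1 - 1/p`) for `2 ≤ p ≤ ∞`. -/
noncomputable def Cp (p : ℝ≥0∞) : ℝ :=
  if p ≤ 2 then Real.sqrt 2 else (2 : ℝ) ^ (1 - 1/p).toReal

open scoped Matrix in
/-- `A` has a spectral decomposition whose eigenvalues are bounded by `c * x j ^ α` for a
subprobability vector `x`, i.e. its spectral `1/α`-norm is at most `c`. -/
def SpectralBound {n : ℕ} (α c : ℝ) (A : Matrix (Fin n) (Fin n) ℂ) : Prop :=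
  ∃ (U : Matrix (Fin n) (Fin n) ℂ) (d x : Fin n → ℝ), Uᴴ * U = 1 ∧
    A = U * Matrix.diagonal (fun j => (d j : ℂ)) * Uᴴ ∧
    (∀ j, 0 ≤ x j) ∧ ∑ j, x j ≤ 1 ∧ ∀ j, |d j| ≤ c * x j ^ α

namespace SpectralBound

open Matrix

variable {n : ℕ}

lemma sum_norm_sq_col (M : Matrix (Fin n) (Fin n) ℂ) (j : Fin n) :
    ((∑ k, ‖M k j‖ ^ 2 : ℝ) : ℂ) = (Mᴴ * M) j j := by
  simp [mul_apply, conjTranspose_apply, RCLike.conj_mul]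

/-- The columns of `B * U` satisfy the same type of bound as the eigenvalues of `B`. -/
lemma exists_col_bound {β c : ℝ} (hβ0 : 0 ≤ β) (hβ : β ≤ 1 / 2) (hc : 0 ≤ c)
    {B : Matrix (Fin n) (Fin n) ℂ} (hB : SpectralBound β c B)
    {U : Matrix (Fin n) (Fin n) ℂ} (hU : Uᴴ * U = 1) :
    ∃ y : Fin n → ℝ, (∀ j, 0 ≤ y j) ∧ ∑ j, y j ≤ 1 ∧
      ∀ j, √(∑ k, ‖(B * U) k j‖ ^ 2) ≤ c * y j ^ β := by
  obtain ⟨V, d, x, hV, rfl, hx0, hx1, hd⟩ := hB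
  have hU' : U * Uᴴ = 1 := mul_eq_one_comm.mp hU
  have hV' : V * Vᴴ = 1 := mul_eq_one_comm.mp hV
  set W := Vᴴ * U with hW
  have hW1 : Wᴴ * W = 1 := by
    rw [hW, conjTranspose_mul, conjTranspose_conjTranspose, Matrix.mul_assoc,
      ← Matrix.mul_assoc V, hV', Matrix.one_mul, hU]
  have hW2 : Wᴴᴴ * Wᴴ = 1 := by
    rw [conjTranspose_conjTranspose]; exact mul_eq_one_comm.mp hW1
  have hcol : ∀ j, ∑ l, ‖W l j‖ ^ 2 = 1 := fun j => by
    have := sum_norm_sq_col W j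
    rw [hW1, one_apply_eq] at this
    exact_mod_cast this
  have hrow : ∀ l, ∑ j, ‖W l j‖ ^ 2 = 1 := fun l => by
    have := sum_norm_sq_col Wᴴ l
    rw [hW2, one_apply_eq] at this
    simp only [conjTranspose_apply, norm_star] at this
    exact_mod_cast this
  have hsum : ∀ j, ∑ k, ‖(V * diagonal (fun j => (d j : ℂ)) * Vᴴ * U) k j‖ ^ 2
      = ∑ l, ‖W l j‖ ^ 2 * d l ^ 2 := fun j => by
    have h1 := sum_norm_sq_col (V * diagonal (fun j => (d j : ℂ)) * Vᴴ * U) j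
    have h2 := sum_norm_sq_col (diagonal (fun j => (d j : ℂ)) * W) j
    have h3 : (V * diagonal (fun j => (d j : ℂ)) * Vᴴ * U)
        = V * (diagonal (fun j => (d j : ℂ)) * W) := by
      simp only [hW, Matrix.mul_assoc]
    have h4 : (V * (diagonal (fun j => (d j : ℂ)) * W))ᴴ
        * (V * (diagonal (fun j => (d j : ℂ)) * W))
        = (diagonal (fun j => (d j : ℂ)) * W)ᴴ * (diagonal (fun j => (d j : ℂ)) * W) := by
      rw [conjTranspose_mul V, Matrix.mul_assoc, ← Matrix.mul_assoc Vᴴ, hV, Matrix.one_mul]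
    rw [h3, h4, ← h2] at h1
    rw [h3, Complex.ofReal_injective h1]
    refine Finset.sum_congr rfl fun l _ => ?_
    rw [diagonal_mul, norm_mul, mul_pow, Complex.norm_real, Real.norm_eq_abs, sq_abs, mul_comm]
  refine ⟨fun j => ∑ l, ‖W l j‖ ^ 2 * x l, fun j => Finset.sum_nonneg fun l _ =>
    mul_nonneg (sq_nonneg _) (hx0 l), ?_, fun j => ?_⟩
  · rw [Finset.sum_comm]
    simpa only [← Finset.sum_mul, hrow, one_mul] using hx1
  · have hy0 : 0 ≤ ∑ l, ‖W l j‖ ^ 2 * x l :=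
      Finset.sum_nonneg fun l _ => mul_nonneg (sq_nonneg _) (hx0 l)
    rw [hsum]
    refine Real.sqrt_le_iff.mpr ⟨mul_nonneg hc (Real.rpow_nonneg hy0 _), ?_⟩
    have hjensen := (Real.concaveOn_rpow (p := 2 * β) (by linarith) (by linarith)).le_map_sum
      (t := Finset.univ) (w := fun l => ‖W l j‖ ^ 2) (p := x) (fun l _ => sq_nonneg _) (hcol j)
      (fun l _ => hx0 l)
    simp only [smul_eq_mul] at hjensen
    have hpow : ∀ t : ℝ, 0 ≤ t → (t ^ β) ^ 2 = t ^ (2 * β) := fun t ht => by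
      rw [← Real.rpow_natCast, ← Real.rpow_mul ht, mul_comm]; norm_num
    calc ∑ l, ‖W l j‖ ^ 2 * d l ^ 2
        ≤ ∑ l, ‖W l j‖ ^ 2 * (c ^ 2 * x l ^ (2 * β)) := by
          refine Finset.sum_le_sum fun l _ => mul_le_mul_of_nonneg_left ?_ (sq_nonneg _)
          rw [← hpow _ (hx0 l), ← mul_pow, ← sq_abs]
          exact pow_le_pow_left₀ (abs_nonneg _) (hd l) 2
      _ = c ^ 2 * ∑ l, ‖W l j‖ ^ 2 * x l ^ (2 * β) := by
          rw [Finset.mul_sum]; exact Finset.sum_congr rfl fun l _ => by ring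
      _ ≤ c ^ 2 * (∑ l, ‖W l j‖ ^ 2 * x l) ^ (2 * β) :=
          mul_le_mul_of_nonneg_left hjensen (sq_nonneg _)
      _ = _ := by rw [mul_pow, hpow _ hy0]

lemma isHermitian {α c : ℝ} {A : Matrix (Fin n) (Fin n) ℂ} (hA : SpectralBound α c A) :
    A.IsHermitian := by
  obtain ⟨U, d, x, -, rfl, -⟩ := hA
  simp [IsHermitian, conjTranspose_mul, diagonal_conjTranspose, Matrix.mul_assoc,
    Pi.star_def]

lemma norm_trace_mul_le_of_le_half {α β γ a b c : ℝ} (hα : 0 ≤ α) (hβ0 : 0 ≤ β) (hγ0 : 0 ≤ γ)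
    (hβ : β ≤ 1 / 2) (hγ : γ ≤ 1 / 2) (hsum : α + β + γ = 1)
    (ha : 0 ≤ a) (hb : 0 ≤ b) (hc : 0 ≤ c) {A B C : Matrix (Fin n) (Fin n) ℂ}
    (hA : SpectralBound α a A) (hB : SpectralBound β b B) (hC : SpectralBound γ c C) :
    ‖(A * B * C).trace‖ ≤ a * b * c := by
  have hBH := hB.isHermitian
  obtain ⟨U, d, x, hU, rfl, hx0, hx1, hd⟩ := hA
  obtain ⟨y, hy0, hy1, hy⟩ := hB.exists_col_bound hβ0 hβ hb hU
  obtain ⟨z, hz0, hz1, hz⟩ := hC.exists_col_bound hγ0 hγ hc hU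
  have htr : (U * diagonal (fun j => (d j : ℂ)) * Uᴴ * B * C).trace
      = ∑ j, (d j : ℂ) * ∑ k, star ((B * U) k j) * (C * U) k j := by
    have : U * diagonal (fun j => (d j : ℂ)) * Uᴴ * B * C
        = U * (diagonal (fun j => (d j : ℂ)) * (Uᴴ * B * C)) := by
      simp only [Matrix.mul_assoc]
    rw [this, trace_mul_comm]
    have h2 : diagonal (fun j => (d j : ℂ)) * (Uᴴ * B * C) * U
        = diagonal (fun j => (d j : ℂ)) * ((B * U)ᴴ * (C * U)) := by
      rw [conjTranspose_mul, hBH.eq]; simp only [Matrix.mul_assoc]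
    rw [h2]
    simp only [trace, diag_apply, diagonal_mul, mul_apply (M := (B * U)ᴴ), conjTranspose_apply]
  rw [htr]
  have hterm : ∀ j, ‖(d j : ℂ) * ∑ k, star ((B * U) k j) * (C * U) k j‖
      ≤ a * b * c * (α * x j + β * y j + γ * z j) := fun j => by
    have hcs : ‖∑ k, star ((B * U) k j) * (C * U) k j‖ ≤ (b * y j ^ β) * (c * z j ^ γ) := by
      calc ‖∑ k, star ((B * U) k j) * (C * U) k j‖
          ≤ ∑ k, ‖(B * U) k j‖ * ‖(C * U) k j‖ :=
            (norm_sum_le _ _).trans_eq (by simp only [norm_mul, norm_star])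
        _ ≤ √(∑ k, ‖(B * U) k j‖ ^ 2) * √(∑ k, ‖(C * U) k j‖ ^ 2) :=
            Real.sum_mul_le_sqrt_mul_sqrt _ _ _
        _ ≤ _ := mul_le_mul (hy j) (hz j) (Real.sqrt_nonneg _)
            (mul_nonneg hb (Real.rpow_nonneg (hy0 j) _))
    have hgm := Real.geom_mean_le_arith_mean3_weighted hα hβ0 hγ0 (hx0 j) (hy0 j) (hz0 j) hsum
    rw [norm_mul, Complex.norm_real, Real.norm_eq_abs]
    calc |d j| * ‖∑ k, star ((B * U) k j) * (C * U) k j‖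
        ≤ (a * x j ^ α) * ((b * y j ^ β) * (c * z j ^ γ)) :=
          mul_le_mul (hd j) hcs (norm_nonneg _) (mul_nonneg ha (Real.rpow_nonneg (hx0 j) _))
      _ = a * b * c * (x j ^ α * y j ^ β * z j ^ γ) := by ring
      _ ≤ _ := mul_le_mul_of_nonneg_left hgm (by positivity)
  calc _ ≤ ∑ j, a * b * c * (α * x j + β * y j + γ * z j) :=
        (norm_sum_le _ _).trans (Finset.sum_le_sum fun j _ => hterm j)
    _ = a * b * c * (α * ∑ j, x j + β * ∑ j, y j + γ * ∑ j, z j) := by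
        simp only [← Finset.mul_sum, Finset.sum_add_distrib]
    _ ≤ a * b * c * 1 := by
        refine mul_le_mul_of_nonneg_left ?_ (by positivity)
        nlinarith
    _ = _ := mul_one _

/-- The trilinear trace form of Hermitian matrices satisfies Hölder's inequality. -/
lemma norm_trace_mul_le {α β γ a b c : ℝ} (hα : 0 ≤ α) (hβ : 0 ≤ β) (hγ : 0 ≤ γ)
    (hsum : α + β + γ = 1) (ha : 0 ≤ a) (hb : 0 ≤ b) (hc : 0 ≤ c)
    {A B C : Matrix (Fin n) (Fin n) ℂ}
    (hA : SpectralBound α a A) (hB : SpectralBound β b B) (hC : SpectralBound γ c C) :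
    ‖(A * B * C).trace‖ ≤ a * b * c := by
  by_cases h1 : β ≤ 1 / 2
  · by_cases h2 : γ ≤ 1 / 2
    · exact norm_trace_mul_le_of_le_half hα hβ hγ h1 h2 hsum ha hb hc hA hB hC
    · rw [trace_mul_cycle]
      calc _ ≤ c * a * b := norm_trace_mul_le_of_le_half hγ hα hβ (by linarith) h1
            (by linarith) hc ha hb hC hA hB
        _ = _ := by ring
  · rw [← trace_mul_cycle B C A]
    calc _ ≤ b * c * a := norm_trace_mul_le_of_le_half hβ hγ hα (by linarith) (by linarith)
          (by linarith) hb hc ha hB hC hA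
      _ = _ := by ring

end SpectralBound

lemma Matrix.IsHermitian.eq_eigenvectorUnitary_mul_diagonal {n : ℕ}
    {A : Matrix (Fin n) (Fin n) ℂ} (hA : A.IsHermitian) :
    A = (hA.eigenvectorUnitary : Matrix (Fin n) (Fin n) ℂ)
      * Matrix.diagonal (fun j => (hA.eigenvalues j : ℂ))
      * (hA.eigenvectorUnitary : Matrix (Fin n) (Fin n) ℂ).conjTranspose := by
  conv_lhs => rw [hA.spectral_theorem]
  rfl

lemma specPNorm_nonneg {n : ℕ} (p : ℝ≥0∞) (A : Matrix (Fin n) (Fin n) ℂ) :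
    0 ≤ specPNorm p A := by
  unfold specPNorm
  split_ifs
  · exact Real.iSup_nonneg fun i => abs_nonneg _
  · positivity
  · exact le_rfl

lemma specPNorm_spectralBound {n : ℕ} {p : ℝ≥0∞} (hp : 1 ≤ p) {A : Matrix (Fin n) (Fin n) ℂ}
    (hA : A.IsHermitian) : SpectralBound (1 / p).toReal (specPNorm p A) A := by
  have hU : (hA.eigenvectorUnitary : Matrix (Fin n) (Fin n) ℂ).conjTranspose
      * hA.eigenvectorUnitary = 1 := Unitary.coe_star_mul_self _
  by_cases hpt : p = ∞
  · refine ⟨_, _, 0, hU, hA.eq_eigenvectorUnitary_mul_diagonal, by simp, by simp, fun j => ?_⟩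
    have hle := le_ciSup (f := fun i => |hA.eigenvalues i|) (Set.finite_range _).bddAbove j
    simpa [specPNorm, hA, hpt] using hle
  have hp0 : 0 < p.toReal := ENNReal.toReal_pos (by positivity) hpt
  set D := ∑ i, |hA.eigenvalues i| ^ p.toReal with hD
  have hD0 : 0 ≤ D := by positivity
  have hN : specPNorm p A = D ^ (1 / p.toReal) := by simp [specPNorm, hA, hpt, hD]
  refine ⟨_, _, fun j => |hA.eigenvalues j| ^ p.toReal / D, hU,
    hA.eq_eigenvectorUnitary_mul_diagonal, fun j => by positivity, ?_, fun j => ?_⟩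
  · rw [← Finset.sum_div]
    exact div_self_le_one D
  · rw [hN, ENNReal.toReal_div, ENNReal.toReal_one, Real.div_rpow (by positivity) hD0,
      ← Real.rpow_mul (abs_nonneg _), mul_one_div_cancel hp0.ne', Real.rpow_one]
    rcases hD0.eq_or_lt with h0 | h0
    · have hj : |hA.eigenvalues j| ^ p.toReal = 0 :=
        (Finset.sum_eq_zero_iff_of_nonneg fun i _ => by positivity).mp h0.symm j
          (Finset.mem_univ j)
      rw [(Real.rpow_eq_zero (abs_nonneg _) hp0.ne').mp hj]
      simp
    · rw [mul_div_cancel₀ _ (Real.rpow_pos_of_pos h0 _).ne']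

/-- The spectral `s`-norm is attained by the trace pairing with the dual unit ball. -/
lemma exists_spectralBound_trace_eq_specPNorm {n : ℕ} {s : ℝ≥0∞} (hs : 1 ≤ s) (hst : s ≠ ∞)
    {X : Matrix (Fin n) (Fin n) ℂ} (hX : X.IsHermitian) :
    ∃ Y, SpectralBound (1 - (1 / s).toReal) 1 Y ∧ (X * Y).trace = (specPNorm s X : ℂ) := by
  have hs1 : 1 ≤ s.toReal := by
    simpa using (ENNReal.toReal_le_toReal ENNReal.one_ne_top hst).mpr hs
  set t := s.toReal with ht
  have ht0 : 0 < t := by linarith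
  set U := (hX.eigenvectorUnitary : Matrix (Fin n) (Fin n) ℂ)
  have hU : U.conjTranspose * U = 1 := Unitary.coe_star_mul_self _
  set e := hX.eigenvalues
  set D := ∑ i, |e i| ^ t with hD
  have hD0 : 0 ≤ D := by positivity
  have hN : specPNorm s X = D ^ (1 / t) := by simp [specPNorm, hX, hst, hD, e, ht]
  have hγ : 1 - (1 / s).toReal = 1 - 1 / t := by rw [ENNReal.toReal_div, ENNReal.toReal_one]
  have hinv : 1 / t ≤ 1 := by rw [div_le_one ht0]; exact hs1
  set γ := 1 - 1 / t with hγd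
  set y : Fin n → ℝ := fun j => SignType.sign (e j) * (|e j| ^ t / D) ^ γ with hy
  refine ⟨U * Matrix.diagonal (fun j => (y j : ℂ)) * U.conjTranspose, ?_, ?_⟩
  · rw [hγ]
    refine ⟨U, y, fun j => |e j| ^ t / D, hU, rfl, fun j => by positivity, ?_, fun j => ?_⟩
    · rw [← Finset.sum_div]
      exact div_self_le_one D
    · rw [hy, abs_mul, abs_of_nonneg (a := (|e j| ^ t / D) ^ γ) (by positivity)]
      refine mul_le_mul_of_nonneg_right ?_ (by positivity)
      rcases lt_trichotomy (e j) 0 with h | h | h <;> simp [h]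
  · have htr : (X * (U * Matrix.diagonal (fun j => (y j : ℂ)) * U.conjTranspose)).trace
        = ((∑ j, e j * y j : ℝ) : ℂ) := by
      have hXe : X = U * Matrix.diagonal (fun j => (e j : ℂ)) * U.conjTranspose :=
        hX.eq_eigenvectorUnitary_mul_diagonal
      have hprod : X * (U * Matrix.diagonal (fun j => (y j : ℂ)) * U.conjTranspose)
          = U * (Matrix.diagonal (fun j => (e j : ℂ)) * (U.conjTranspose * U)
            * Matrix.diagonal (fun j => (y j : ℂ)) * U.conjTranspose) := by
        conv_lhs => rw [hXe]
        simp only [Matrix.mul_assoc]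
      rw [hprod, hU, Matrix.mul_one, Matrix.trace_mul_comm, Matrix.mul_assoc, hU,
        Matrix.mul_one, Matrix.diagonal_mul_diagonal, Matrix.trace_diagonal]
      push_cast
      rfl
    rw [htr, hN]
    congr 1
    have hterm : ∀ j, e j * y j = |e j| ^ t / D ^ γ := fun j => by
      have h1 : e j * y j = |e j| * (|e j| ^ t / D) ^ γ := by
        rw [hy, ← mul_assoc, self_mul_sign]
      have h2 : t * γ = t - 1 := by rw [hγd]; field_simp
      rw [h1, Real.div_rpow (by positivity) hD0, ← Real.rpow_mul (abs_nonneg _), h2,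
        ← mul_div_assoc]
      congr 1
      nth_rewrite 1 [← Real.rpow_one |e j|]
      rw [← Real.rpow_add' (abs_nonneg _) (by linarith)]
      congr 1
      ring
    simp only [hterm, ← Finset.sum_div]
    rw [← hD]
    rcases hD0.eq_or_lt with h0 | h0
    · rw [← h0, zero_div, Real.zero_rpow (by positivity)]
    · nth_rewrite 1 [← Real.rpow_one D]
      rw [← Real.rpow_sub h0]
      congr 1
      ring

lemma one_le_Cp (p : ℝ≥0∞) : 1 ≤ Cp p := by
  unfold Cp
  split_ifs
  · exact Real.one_le_sqrt.mpr one_le_two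
  · exact Real.one_le_rpow one_le_two ENNReal.toReal_nonneg

/-- The sharp Hölder inequality for the Jordan product of Hermitian matrices. -/
lemma specPNorm_jordan_mul_le {n : ℕ} {r s p : ℝ≥0∞} (hr : 1 ≤ r) (hs : 1 ≤ s) (hp : 1 ≤ p)
    (hst : s ≠ ∞) (hspr : 1 / s = 1 / p + 1 / r)
    {A B : Matrix (Fin n) (Fin n) ℂ} (hA : A.IsHermitian) (hB : B.IsHermitian) :
    specPNorm s ((1/2 : ℂ) • (A * B + B * A)) ≤ specPNorm p A * specPNorm r B := by
  have hX : ((1/2 : ℂ) • (A * B + B * A)).IsHermitian := by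
    simp [Matrix.IsHermitian, Matrix.conjTranspose_smul, Matrix.conjTranspose_mul, hA.eq, hB.eq,
      add_comm]
  obtain ⟨Y, hY, htr⟩ := exists_spectralBound_trace_eq_specPNorm hs hst hX
  have hfin : ∀ u : ℝ≥0∞, 1 ≤ u → 1 / u ≠ ∞ := fun u hu => by
    simp [(zero_lt_one.trans_le hu).ne']
  have hreal : (1 / s).toReal = (1 / p).toReal + (1 / r).toReal := by
    rw [hspr, ENNReal.toReal_add (hfin p hp) (hfin r hr)]
  have hle : (1 / s).toReal ≤ 1 := by
    refine ENNReal.toReal_le_of_le_ofReal zero_le_one ?_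
    simpa using hs
  have hAs := specPNorm_spectralBound hp hA
  have hBs := specPNorm_spectralBound hr hB
  have hγ : 0 ≤ 1 - (1 / s).toReal := by linarith
  have h1 := SpectralBound.norm_trace_mul_le ENNReal.toReal_nonneg ENNReal.toReal_nonneg hγ
    (by linarith) (specPNorm_nonneg p A) (specPNorm_nonneg r B) zero_le_one hAs hBs hY
  have h2 := SpectralBound.norm_trace_mul_le ENNReal.toReal_nonneg ENNReal.toReal_nonneg hγ
    (by linarith) (specPNorm_nonneg r B) (specPNorm_nonneg p A) zero_le_one hBs hAs hY
  have hnorm : specPNorm s ((1/2 : ℂ) • (A * B + B * A))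
      = ‖(1/2 : ℂ) * ((A * B * Y).trace + (B * A * Y).trace)‖ := by
    rw [Matrix.smul_mul, Matrix.trace_smul, Matrix.add_mul, Matrix.trace_add, smul_eq_mul] at htr
    rw [htr, Complex.norm_real, Real.norm_of_nonneg (specPNorm_nonneg _ _)]
  rw [hnorm, norm_mul]
  have h3 := norm_add_le (A * B * Y).trace (B * A * Y).trace
  have h4 : ‖(1/2 : ℂ)‖ = 1 / 2 := by norm_num
  rw [h4]
  linarith

/-- Generalized Hölder type inequality for the Jordan product of Hermitian matrices:
if `r ≠ s`, `1/s = 1/p + 1/r` and `q` is the conjugate exponent of `p`, then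
`‖(AB+BA)/2‖_s ≤ 2 C_q ‖A‖_p ‖B‖_r`. -/
theorem generalized_holder {n : ℕ} (r s p q : ℝ≥0∞)
    (hr : 1 ≤ r) (hs : 1 ≤ s) (hp : 1 ≤ p) (hrs : r ≠ s)
    (hspr : 1 / s = 1 / p + 1 / r) (hq : 1 / p + 1 / q = 1)
    (A B : Matrix (Fin n) (Fin n) ℂ) (hA : A.IsHermitian) (hB : B.IsHermitian) :
    specPNorm s ((1/2 : ℂ) • (A * B + B * A)) ≤ 2 * Cp q * specPNorm p A * specPNorm r B := by
  have hst : s ≠ ∞ := by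
    rintro rfl
    simp only [one_div, ENNReal.inv_top] at hspr
    exact hrs (ENNReal.inv_eq_zero.mp (add_eq_zero.mp hspr.symm).2)
  have hC := one_le_Cp q
  have hAB := mul_nonneg (specPNorm_nonneg p A) (specPNorm_nonneg r B)
  calc _ ≤ specPNorm p A * specPNorm r B := specPNorm_jordan_mul_le hr hs hp hst hspr hA hB
    _ ≤ 2 * Cp q * (specPNorm p A * specPNorm r B) := le_mul_of_one_le_left hAB (by linarith)
    _ = _ := by ring
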